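/- In the category $\mathrm{Ch}(R)$ of unbounded chain complexes of modules over a ring $R$, an object is finitely presentable (compact: its hom-functor preserves filtered colimits) if and only if it is a bounded complex of finitely presentable $R$-modules. -/

import Mathlib

open CategoryTheory CategoryTheory.Limits

universe u

/-- An object `X` is finitely presentable (compact) if its hom-functor preserves
filtered colimits. -/
def IsFinitelyPresentableObj {C : Type (u + 1)} [Category.{u} C] (X : C) : Prop :=
  ∀ (J : Type u) [SmallCategory J] [IsFiltered J],
    Nonempty (PreservesColimitsOfShape J (coyoneda.obj (Opposite.op X)))

section Compactness

variable {C : Type (u + 1)} [Category.{u} C]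

lemma isFinitelyPresentableObj_of_exists {X : C}
    (hsurj : ∀ (J : Type u) [SmallCategory J] [IsFiltered J] (F : J ⥤ C) (c : Cocone F),
      IsColimit c → ∀ f : X ⟶ c.pt, ∃ (j : J) (p : X ⟶ F.obj j), p ≫ c.ι.app j = f)
    (hinj : ∀ (J : Type u) [SmallCategory J] [IsFiltered J] (F : J ⥤ C) (c : Cocone F),
      IsColimit c → ∀ (i : J) (f g : X ⟶ F.obj i), f ≫ c.ι.app i = g ≫ c.ι.app i →
        ∃ (k : J) (u : i ⟶ k), f ≫ F.map u = g ≫ F.map u) :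
    IsFinitelyPresentableObj X := by
  intro J _ _
  refine ⟨⟨fun {F} => ⟨fun {c} hc => ⟨Types.FilteredColimit.isColimitOf' _ _ ?_ ?_⟩⟩⟩⟩
  · intro f
    obtain ⟨j, p, hp⟩ := hsurj J F c hc f
    exact ⟨j, p, hp.symm⟩
  · exact hinj J F c hc

lemma IsFinitelyPresentableObj.exists_hom {X : C} (hX : IsFinitelyPresentableObj X)
    {J : Type u} [SmallCategory J] [IsFiltered J] {F : J ⥤ C} {c : Cocone F}
    (hc : IsColimit c) (f : X ⟶ c.pt) : ∃ (j : J) (p : X ⟶ F.obj j), p ≫ c.ι.app j = f :=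
  have := (hX J).some
  exists_hom_of_preservesColimit_coyoneda hc f

lemma IsFinitelyPresentableObj.exists_eq {X : C} (hX : IsFinitelyPresentableObj X)
    {J : Type u} [SmallCategory J] [IsFiltered J] {F : J ⥤ C} {c : Cocone F}
    (hc : IsColimit c) {i : J} (f g : X ⟶ F.obj i) (h : f ≫ c.ι.app i = g ≫ c.ι.app i) :
    ∃ (k : J) (u : i ⟶ k), f ≫ F.map u = g ≫ F.map u :=
  have := (hX J).some
  exists_eq_of_preservesColimit_coyoneda_self hc f g h

end Compactness

lemma CategoryTheory.IsFiltered.exists_forall_mem {J : Type*} [Category J] [IsFiltered J]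
    {α : Type*} (s : Finset α) (P : α → J → Prop)
    (hP : ∀ a i j, (i ⟶ j) → P a i → P a j) (h : ∀ a ∈ s, ∃ j, P a j) :
    ∃ j, ∀ a ∈ s, P a j := by
  classical
  induction s using Finset.induction_on with
  | empty => exact ⟨IsFiltered.nonempty.some, by simp⟩
  | insert a s _ ih =>
    obtain ⟨j, hj⟩ := ih fun b hb => h b (Finset.mem_insert_of_mem hb)
    obtain ⟨k, hk⟩ := h a (Finset.mem_insert_self a s)
    refine ⟨IsFiltered.max j k, fun b hb => ?_⟩
    obtain rfl | hb := Finset.mem_insert.1 hb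
    · exact hP _ _ _ (IsFiltered.rightToMax j k) hk
    · exact hP _ _ _ (IsFiltered.leftToMax j k) (hj b hb)

namespace ModuleCat

variable {R : Type u} [Ring R]

lemma exists_comp_map_eq_of_finite {J : Type u} [SmallCategory J] [IsFiltered J]
    {F : J ⥤ ModuleCat.{u} R} {c : Cocone F} (hc : IsColimit c) {M : ModuleCat.{u} R}
    [Module.Finite R M] {i : J} (f g : M ⟶ F.obj i) (h : f ≫ c.ι.app i = g ≫ c.ι.app i) :
    ∃ (k : J) (u : i ⟶ k), f ≫ F.map u = g ≫ F.map u := by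
  obtain ⟨s, hs⟩ := Module.Finite.fg_top (R := R) (M := M)
  obtain ⟨k, hk⟩ := IsFiltered.exists_forall_mem (J := Under i) s
    (fun x k => F.map k.hom (f x) = F.map k.hom (g x)) (fun x k l u hx => by
      rw [← Under.w u, F.map_comp, comp_apply, comp_apply, hx]) (fun x _ => by
      obtain ⟨k, u, hu⟩ := (Types.FilteredColimit.isColimit_eq_iff'
        (isColimitOfPreserves (forget _) hc) (f x) (g x)).1 (ConcreteCategory.congr_hom h x)
      exact ⟨Under.mk u, hu⟩)
  refine ⟨k.right, k.hom, hom_ext (LinearMap.ext_on hs fun x hx => ?_)⟩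
  exact hk x hx

lemma isFinitelyPresentableObj_of_finitePresentation (M : ModuleCat.{u} R)
    [Module.FinitePresentation R M] : IsFinitelyPresentableObj M := by
  refine isFinitelyPresentableObj_of_exists ?_
    fun J _ _ F c hc i f g h => exists_comp_map_eq_of_finite hc f g h
  intro J _ _ F c hc f
  obtain ⟨n, m, p, q, hp, hpq⟩ := Module.FinitePresentation.exists_fin' R M
  obtain ⟨j, hj⟩ := IsFiltered.exists_forall_mem (J := J) (Finset.univ : Finset (Fin n))
    (fun a j => ∃ y : F.obj j, c.ι.app j y = f (p (Pi.single a 1)))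
    (fun a i j u ⟨y, hy⟩ => ⟨F.map u y, by
      rw [← hy, ← comp_apply, c.w]⟩)
    (fun a _ => Concrete.isColimit_exists_rep F hc _)
  choose y hy using fun a => hj a (Finset.mem_univ a)
  let φ : (Fin n → R) →ₗ[R] F.obj j := (Pi.basisFun R (Fin n)).constr ℕ y
  have hφ : ofHom φ ≫ c.ι.app j = ofHom p ≫ f := by
    refine hom_ext ((Pi.basisFun R (Fin n)).ext fun a => ?_)
    have : φ (Pi.single a 1) = y a := by
      rw [← Pi.basisFun_apply]
      exact (Pi.basisFun R (Fin n)).constr_basis ℕ y a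
    simp [this, hy]
  obtain ⟨k, u, hu⟩ := exists_comp_map_eq_of_finite hc (M := of R (Fin m → R))
    (ofHom (φ ∘ₗ q)) 0 (by
      rw [ofHom_comp, Category.assoc, hφ, zero_comp, ← Category.assoc, ← ofHom_comp,
        hpq.linearMap_comp_eq_zero]
      exact zero_comp)
  have hker : LinearMap.ker p ≤ LinearMap.ker ((F.map u).hom ∘ₗ φ) := by
    intro x hx
    obtain ⟨z, rfl⟩ := (hpq x).1 hx
    simpa using ConcreteCategory.congr_hom hu z
  let ψ : M →ₗ[R] F.obj k :=
    (LinearMap.ker p).liftQ _ hker ∘ₗ (p.quotKerEquivOfSurjective hp).symm.toLinearMap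
  have hψ (x) : ψ (p x) = F.map u (φ x) := by
    have : (p.quotKerEquivOfSurjective hp).symm (p x) = (LinearMap.ker p).mkQ x := by
      rw [LinearEquiv.symm_apply_eq]; rfl
    simp [ψ, this]
  refine ⟨k, ofHom ψ, hom_ext (LinearMap.ext fun x => ?_)⟩
  obtain ⟨x, rfl⟩ := hp x
  have h₁ : c.ι.app k (F.map u (φ x)) = c.ι.app j (φ x) := by
    rw [← comp_apply, c.w]
  have h₂ := ConcreteCategory.congr_hom hφ x
  simpa [hψ, h₁] using h₂

section FGQuotients

variable {P : Type u} [AddCommGroup P] [Module R P] (K : Submodule R P)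

/-- The finitely generated submodules of `K`. -/
abbrev FGSubmodule : Type u := {N : Submodule R P // N.FG ∧ N ≤ K}

instance : Nonempty (FGSubmodule K) := ⟨⟨⊥, Submodule.fg_bot, bot_le⟩⟩

instance : IsDirectedOrder (FGSubmodule K) where
  directed a b := ⟨⟨a.1 ⊔ b.1, a.2.1.sup b.2.1, sup_le a.2.2 b.2.2⟩,
    show a.1 ≤ a.1 ⊔ b.1 from le_sup_left, show b.1 ≤ a.1 ⊔ b.1 from le_sup_right⟩

/-- The quotients of `P` by the finitely generated submodules of `K`. -/
def fgQuotients : FGSubmodule K ⥤ ModuleCat.{u} R where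
  obj N := of R (P ⧸ N.1)
  map u := ofHom (Submodule.factor (leOfHom u))
  map_id _ := hom_ext (Submodule.linearMap_qext _ rfl)
  map_comp _ _ := hom_ext (Submodule.linearMap_qext _ rfl)

/-- The quotient by `K` as a cocone under the quotients by its finitely generated submodules. -/
def fgQuotientsCocone : Cocone (fgQuotients K) where
  pt := of R (P ⧸ K)
  ι :=
    { app N := ofHom (Submodule.factor N.2.2)
      naturality _ _ _ := hom_ext (Submodule.linearMap_qext _ rfl) }

/-- The quotient by `K` is the colimit of the quotients by its finitely generated submodules. -/
def isColimitFgQuotientsCocone : IsColimit (fgQuotientsCocone K) := by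
  have key (s : Cocone (fgQuotients K)) (N : FGSubmodule K) (x : P) :
      (s.ι.app N).hom (N.1.mkQ x) =
        (s.ι.app ⟨⊥, Submodule.fg_bot, bot_le⟩).hom ((⊥ : Submodule R P).mkQ x) := by
    have hN : (⟨⊥, Submodule.fg_bot, bot_le⟩ : FGSubmodule K) ≤ N :=
      show (⊥ : Submodule R P) ≤ N.1 from bot_le
    rw [← s.w (homOfLE hN)]
    rfl
  exact
  { desc s := ofHom (K.liftQ
      ((s.ι.app ⟨⊥, Submodule.fg_bot, bot_le⟩).hom ∘ₗ (⊥ : Submodule R P).mkQ) (by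
        intro x hx
        let N : FGSubmodule K := ⟨Submodule.span R {x}, Submodule.fg_span_singleton x,
          (Submodule.span_singleton_le_iff_mem x K).2 hx⟩
        have hN : N.1.mkQ x = 0 := by
          simp [N]
        exact (key s N x).symm.trans
          ((congrArg (s.ι.app N).hom hN).trans (map_zero (s.ι.app N).hom))))
    fac s N := hom_ext (Submodule.linearMap_qext _ (LinearMap.ext fun x => (key s N x).symm))
    uniq s m hm := by
      refine hom_ext (Submodule.linearMap_qext _ (LinearMap.ext fun x => ?_))
      exact ConcreteCategory.congr_hom (hm ⟨⊥, Submodule.fg_bot, bot_le⟩)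
        ((⊥ : Submodule R P).mkQ x) }

end FGQuotients

lemma finite_of_isFinitelyPresentableObj {M : ModuleCat.{u} R}
    (hM : IsFinitelyPresentableObj M) : Module.Finite R M := by
  let b : FGSubmodule (⊤ : Submodule R M) := ⟨⊥, Submodule.fg_bot, bot_le⟩
  obtain ⟨N, u, h⟩ := hM.exists_eq (isColimitFgQuotientsCocone (⊤ : Submodule R M)) (i := b)
    (ofHom (⊥ : Submodule R M).mkQ) 0 (by
      refine hom_ext (LinearMap.ext fun x => ?_)
      exact (Submodule.Quotient.mk_eq_zero _).2 trivial)
  have hN : N.1 = ⊤ := by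
    refine eq_top_iff.2 fun x _ => ?_
    exact (Submodule.Quotient.mk_eq_zero _).1 (ConcreteCategory.congr_hom h x)
  exact ⟨hN ▸ N.2.1⟩

lemma finitePresentation_of_isFinitelyPresentableObj {M : ModuleCat.{u} R}
    (hM : IsFinitelyPresentableObj M) : Module.FinitePresentation R M := by
  have := finite_of_isFinitelyPresentableObj hM
  obtain ⟨n, p, hp⟩ := Module.Finite.exists_fin' R M
  let e := p.quotKerEquivOfSurjective hp
  obtain ⟨N, σ, hσ⟩ := hM.exists_hom (isColimitFgQuotientsCocone (LinearMap.ker p))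
    (ofHom e.symm.toLinearMap)
  let l : ((Fin n → R) ⧸ N.1) →ₗ[R] M := e.toLinearMap ∘ₗ Submodule.factor N.2.2
  let τ : M →ₗ[R] ((Fin n → R) ⧸ N.1) := σ.hom
  have hl (x : M) : l (τ x) = x :=
    e.eq_symm_apply.1 (ConcreteCategory.congr_hom hσ x)
  have : Module.FinitePresentation R ((Fin n → R) ⧸ N.1) :=
    Module.finitePresentation_of_surjective N.1.mkQ N.1.mkQ_surjective (by
      rw [Submodule.ker_mkQ]; exact N.2.1)
  refine Module.finitePresentation_of_surjective l (fun x => ⟨_, hl x⟩) ?_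
  have hker : LinearMap.ker l = LinearMap.range (LinearMap.id - τ ∘ₗ l) := by
    refine le_antisymm ?_ ?_
    · intro x hx
      refine ⟨x, ?_⟩
      have hx' : l x = 0 := hx
      change x - τ (l x) = x
      simp [hx']
    · rintro _ ⟨x, rfl⟩
      change l (x - τ (l x)) = 0
      rw [map_sub, hl, sub_self]
  rw [hker, LinearMap.range_eq_map]
  exact Module.Finite.fg_top.map _

lemma isFinitelyPresentableObj_iff {M : ModuleCat.{u} R} :
    IsFinitelyPresentableObj M ↔ Module.FinitePresentation R M :=
  ⟨finitePresentation_of_isFinitelyPresentableObj,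
    fun _ => isFinitelyPresentableObj_of_finitePresentation M⟩

end ModuleCat

namespace ChainComplex

variable {C : Type*} [Category C] [Preadditive C] [HasBinaryBiproducts C]

/-- The contractible complex with `M k ⊞ M (k - 1)` in degree `k`, whose differential is induced
by the identity of `M (k - 1)`. -/
noncomputable def cofree (M : ℤ → C) : ChainComplex C ℤ where
  X k := M k ⊞ M (k - 1)
  d i j := if h : i - 1 = j then biprod.snd ≫ eqToHom (by rw [h]) ≫ biprod.inl else 0
  shape i j hij := dif_neg fun h => hij (by simp [← h])
  d_comp_d' i j k _ _ := by
    split_ifs <;> simp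

section

variable (M : ℤ → C) (k : ℤ)

/-- The projection to the first summand. -/
noncomputable def cofreeFst : (cofree M).X k ⟶ M k := biprod.fst

/-- The projection to the second summand. -/
noncomputable def cofreeSnd : (cofree M).X k ⟶ M (k - 1) := biprod.snd

/-- The inclusion of the first summand. -/
noncomputable def cofreeInl : M k ⟶ (cofree M).X k := biprod.inl

/-- The inclusion of the second summand. -/
noncomputable def cofreeInr : M (k - 1) ⟶ (cofree M).X k := biprod.inr

variable {M k}

lemma cofree_hom_ext {A : C} {f g : A ⟶ (cofree M).X k}
    (h₁ : f ≫ cofreeFst M k = g ≫ cofreeFst M k)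
    (h₂ : f ≫ cofreeSnd M k = g ≫ cofreeSnd M k) : f = g :=
  biprod.hom_ext _ _ h₁ h₂

lemma cofree_hom_ext' {A : C} {f g : (cofree M).X k ⟶ A}
    (h₁ : cofreeInl M k ≫ f = cofreeInl M k ≫ g)
    (h₂ : cofreeInr M k ≫ f = cofreeInr M k ≫ g) : f = g :=
  biprod.hom_ext' _ _ h₁ h₂

end

/-- The morphism to a cofree complex determined by its components in the first summand. -/
noncomputable def toCofree (X : ChainComplex C ℤ) {M : ℤ → C} (f : ∀ k, X.X k ⟶ M k) :
    X ⟶ cofree M where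
  f k := biprod.lift (f k) (X.d k (k - 1) ≫ f (k - 1))
  comm' i j hij := by
    obtain rfl : i - 1 = j := by simp [← (show j + 1 = i from hij)]
    apply biprod.hom_ext <;> simp [cofree]

@[simp]
lemma toCofree_f_fst (X : ChainComplex C ℤ) {M : ℤ → C} (f : ∀ k, X.X k ⟶ M k) (k : ℤ) :
    (toCofree X f).f k ≫ cofreeFst M k = f k :=
  biprod.lift_fst _ _

lemma toCofree_f_snd (X : ChainComplex C ℤ) {M : ℤ → C} (f : ∀ k, X.X k ⟶ M k) (k : ℤ) :
    (toCofree X f).f k ≫ cofreeSnd M k = X.d k (k - 1) ≫ f (k - 1) :=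
  biprod.lift_snd _ _

/-- The morphism of cofree complexes induced by a morphism of graded objects. -/
noncomputable def cofreeMap {M N : ℤ → C} (φ : ∀ k, M k ⟶ N k) : cofree M ⟶ cofree N where
  f k := biprod.map (φ k) (φ (k - 1))
  comm' i j hij := by
    obtain rfl : i - 1 = j := by simp [← (show j + 1 = i from hij)]
    simp [cofree]

section

variable {M N P : ℤ → C} (φ : ∀ k, M k ⟶ N k) (ψ : ∀ k, N k ⟶ P k) (k : ℤ)

lemma cofreeMap_f_fst : (cofreeMap φ).f k ≫ cofreeFst N k = cofreeFst M k ≫ φ k :=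
  biprod.map_fst _ _

lemma cofreeMap_f_snd : (cofreeMap φ).f k ≫ cofreeSnd N k = cofreeSnd M k ≫ φ (k - 1) :=
  biprod.map_snd _ _

lemma inl_cofreeMap_f : cofreeInl M k ≫ (cofreeMap φ).f k = φ k ≫ cofreeInl N k :=
  biprod.inl_map _ _

lemma inl_cofreeMap_f_assoc {A : C} (f : (cofree N).X k ⟶ A) :
    cofreeInl M k ≫ (cofreeMap φ).f k ≫ f = φ k ≫ cofreeInl N k ≫ f := by
  rw [← Category.assoc, inl_cofreeMap_f, Category.assoc]

lemma inr_cofreeMap_f : cofreeInr M k ≫ (cofreeMap φ).f k = φ (k - 1) ≫ cofreeInr N k :=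
  biprod.inr_map _ _

lemma inr_cofreeMap_f_assoc {A : C} (f : (cofree N).X k ⟶ A) :
    cofreeInr M k ≫ (cofreeMap φ).f k ≫ f = φ (k - 1) ≫ cofreeInr N k ≫ f := by
  rw [← Category.assoc, inr_cofreeMap_f, Category.assoc]

lemma cofreeMap_id (M : ℤ → C) : cofreeMap (fun k => 𝟙 (M k)) = 𝟙 (cofree M) := by
  ext k : 1
  apply cofree_hom_ext <;> simp [cofreeMap_f_fst, cofreeMap_f_snd]

lemma cofreeMap_comp : cofreeMap (fun k => φ k ≫ ψ k) = cofreeMap φ ≫ cofreeMap ψ := by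
  ext k : 1
  apply cofree_hom_ext <;> simp [cofreeMap_f_fst, cofreeMap_f_snd,
    reassoc_of% cofreeMap_f_fst φ, reassoc_of% cofreeMap_f_snd φ]

lemma toCofree_comp_cofreeMap (X : ChainComplex C ℤ) (f : ∀ k, X.X k ⟶ M k) :
    toCofree X f ≫ cofreeMap φ = toCofree X fun k => f k ≫ φ k := by
  ext k : 1
  apply cofree_hom_ext <;> simp [cofreeMap_f_fst, cofreeMap_f_snd, toCofree_f_snd,
    reassoc_of% toCofree_f_fst X f, reassoc_of% toCofree_f_snd X f]

end

section Colimits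

variable {J : Type*} [Category J] {F : ℤ → J ⥤ C} (c : ∀ n, Cocone (F n))

variable (F) in
/-- The diagram of cofree complexes induced by a family of diagrams. -/
noncomputable def cofreeDiagram : J ⥤ ChainComplex C ℤ where
  obj j := cofree fun n => (F n).obj j
  map u := cofreeMap fun n => (F n).map u
  map_id j := by simp [cofreeMap_id]
  map_comp u v := by simp [cofreeMap_comp]

/-- The cocone of cofree complexes induced by a family of cocones. -/
noncomputable def cofreeCocone : Cocone (cofreeDiagram F) where
  pt := cofree fun n => (c n).pt
  ι :=
    { app j := cofreeMap fun n => (c n).ι.app j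
      naturality i j u := by
        refine (cofreeMap_comp _ _).symm.trans ?_
        simp only [Cocone.w]
        exact (Category.comp_id _).symm }

variable {c} in
/-- A family of colimit cocones induces a colimit cocone of cofree complexes. -/
noncomputable def isColimitCofreeCocone (hc : ∀ n, IsColimit (c n)) :
    IsColimit (cofreeCocone c) :=
  HomologicalComplex.isColimitOfEval _ _ fun k =>
    { desc s := biprod.desc
        ((hc k).desc
          { pt := s.pt
            ι :=
              { app j := cofreeInl (fun n => (F n).obj j) k ≫ s.ι.app j
                naturality i j u := by
                  rw [← s.w u]
                  exact (inl_cofreeMap_f_assoc (fun n => (F n).map u) k (s.ι.app j)).symm.trans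
                    (Category.comp_id _).symm } })
        ((hc (k - 1)).desc
          { pt := s.pt
            ι :=
              { app j := cofreeInr (fun n => (F n).obj j) k ≫ s.ι.app j
                naturality i j u := by
                  rw [← s.w u]
                  exact (inr_cofreeMap_f_assoc (fun n => (F n).map u) k (s.ι.app j)).symm.trans
                    (Category.comp_id _).symm } })
      fac s j := by
        refine cofree_hom_ext' (M := fun n => (F n).obj j) (k := k) ?_ ?_
        · refine (inl_cofreeMap_f_assoc (fun n => (c n).ι.app j) k _).trans ?_
          refine (congrArg (_ ≫ ·) (biprod.inl_desc _ _)).trans ?_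
          exact (hc k).fac _ j
        · refine (inr_cofreeMap_f_assoc (fun n => (c n).ι.app j) k _).trans ?_
          refine (congrArg (_ ≫ ·) (biprod.inr_desc _ _)).trans ?_
          exact (hc (k - 1)).fac _ j
      uniq s m hm := by
        refine cofree_hom_ext' (M := fun n => (c n).pt) (k := k) ?_ ?_
        · refine Eq.trans ?_ (biprod.inl_desc _ _).symm
          refine (hc k).uniq (Cocone.mk s.pt _) _ fun j => ?_
          exact (inl_cofreeMap_f_assoc (fun n => (c n).ι.app j) k m).symm.trans
            (congrArg (_ ≫ ·) (hm j))
        · refine Eq.trans ?_ (biprod.inr_desc _ _).symm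
          refine (hc (k - 1)).uniq (Cocone.mk s.pt _) _ fun j => ?_
          exact (inr_cofreeMap_f_assoc (fun n => (c n).ι.app j) k m).symm.trans
            (congrArg (_ ≫ ·) (hm j)) }

end Colimits

end ChainComplex

namespace IsFinitelyPresentableObj

variable {C : Type (u + 1)} [Category.{u} C] [Preadditive C] [HasBinaryBiproducts C]
  {X : ChainComplex C ℤ} {J : Type u} [SmallCategory J] [IsFiltered J]
  {F : ℤ → J ⥤ C} {c : ∀ n, Cocone (F n)}

lemma exists_graded_hom (hX : IsFinitelyPresentableObj X) (hc : ∀ n, IsColimit (c n))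
    (f : ∀ n, X.X n ⟶ (c n).pt) :
    ∃ (j : J) (p : ∀ n, X.X n ⟶ (F n).obj j), ∀ n, p n ≫ (c n).ι.app j = f n := by
  obtain ⟨j, p, hp⟩ : ∃ (j : J) (p : X ⟶ ChainComplex.cofree fun n => (F n).obj j),
      p ≫ ChainComplex.cofreeMap (fun n => (c n).ι.app j) = ChainComplex.toCofree X f :=
    hX.exists_hom (ChainComplex.isColimitCofreeCocone hc) (ChainComplex.toCofree X f)
  refine ⟨j, fun n => p.f n ≫ ChainComplex.cofreeFst _ n, fun n => ?_⟩
  rw [Category.assoc, ← ChainComplex.cofreeMap_f_fst (fun n => (c n).ι.app j),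
    ← Category.assoc, ← HomologicalComplex.comp_f, hp]
  exact ChainComplex.toCofree_f_fst X f n

lemma exists_graded_eq (hX : IsFinitelyPresentableObj X) (hc : ∀ n, IsColimit (c n))
    {i : J} (f g : ∀ n, X.X n ⟶ (F n).obj i)
    (h : ∀ n, f n ≫ (c n).ι.app i = g n ≫ (c n).ι.app i) :
    ∃ (k : J) (u : i ⟶ k), ∀ n, f n ≫ (F n).map u = g n ≫ (F n).map u := by
  obtain ⟨k, u, hu⟩ := hX.exists_eq (ChainComplex.isColimitCofreeCocone hc) (i := i)
    (ChainComplex.toCofree X f) (ChainComplex.toCofree X g) (by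
      refine (ChainComplex.toCofree_comp_cofreeMap _ X f).trans
        (Eq.trans ?_ (ChainComplex.toCofree_comp_cofreeMap _ X g).symm)
      simp only [h])
  have hu' : (ChainComplex.toCofree X fun n => f n ≫ (F n).map u) =
      ChainComplex.toCofree X fun n => g n ≫ (F n).map u :=
    (ChainComplex.toCofree_comp_cofreeMap _ X f).symm.trans
      (hu.trans (ChainComplex.toCofree_comp_cofreeMap _ X g))
  refine ⟨k, u, fun n => ?_⟩
  simpa using congrArg (fun φ => φ.f n ≫ ChainComplex.cofreeFst _ n) hu'

lemma chainComplex_X (hX : IsFinitelyPresentableObj X) (n : ℤ) :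
    IsFinitelyPresentableObj (X.X n) := by
  refine isFinitelyPresentableObj_of_exists ?_ ?_
  · intro J _ _ F c hc f
    obtain ⟨j, p, hp⟩ := hX.exists_graded_hom (fun _ => hc)
      (fun m => if h : m = n then eqToHom (by rw [h]) ≫ f else 0)
    exact ⟨j, p n, by simpa using hp n⟩
  · intro J _ _ F c hc i f g hfg
    obtain ⟨k, u, hu⟩ := hX.exists_graded_eq (fun _ => hc)
      (fun m => if h : m = n then eqToHom (by rw [h]) ≫ f else 0)
      (fun m => if h : m = n then eqToHom (by rw [h]) ≫ g else 0) (by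
        intro m
        split_ifs <;> simp [hfg])
    exact ⟨k, u, by simpa using hu n⟩

end IsFinitelyPresentableObj

section Bounded

variable {R : Type u} [Ring R] (M : ModuleCat.{u} R) (n : ℤ)

/-- The functor on finite sets of integers which is `M` on the sets that do not contain `n`, and
zero on the others. -/
def finsetComplFunctor : ULift.{u} (Finset ℤ) ⥤ ModuleCat.{u} R where
  obj s := ModuleCat.of R (PLift (n ∉ s.down) → M)
  map u := ModuleCat.ofHom (LinearMap.funLeft R M fun h => ⟨fun hn => h.down (leOfHom u hn)⟩)
  map_id _ := rfl
  map_comp _ _ := rfl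

/-- The zero cocone under `finsetComplFunctor M n`. -/
def finsetComplCocone : Cocone (finsetComplFunctor M n) where
  pt := ModuleCat.of R PUnit
  ι := { app _ := 0 }

/-- The colimit of `finsetComplFunctor M n` is zero. -/
def isColimitFinsetComplCocone : IsColimit (finsetComplCocone M n) where
  desc _ := 0
  fac s i := by
    let j : ULift.{u} (Finset ℤ) := ⟨insert n i.down⟩
    have hij : i ≤ j := Finset.subset_insert n i.down
    have : IsEmpty (PLift (n ∉ j.down)) := ⟨fun h => h.down (Finset.mem_insert_self n _)⟩
    have hj : IsZero ((finsetComplFunctor M n).obj j) :=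
      ModuleCat.isZero_of_subsingleton (ModuleCat.of R (PLift (n ∉ j.down) → M))
    rw [comp_zero, ← s.w (homOfLE hij), hj.eq_of_src (s.ι.app j) 0, comp_zero]
  uniq _ _ _ := (ModuleCat.isZero_of_subsingleton (ModuleCat.of R PUnit)).eq_of_src _ _

lemma IsFinitelyPresentableObj.exists_finset_isZero {X : ChainComplex (ModuleCat.{u} R) ℤ}
    (hX : IsFinitelyPresentableObj X) : ∃ s : Finset ℤ, ∀ n ∉ s, IsZero (X.X n) := by
  let i : ULift.{u} (Finset ℤ) := ⟨∅⟩
  obtain ⟨s, u, h⟩ := hX.exists_graded_eq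
    (fun n => isColimitFinsetComplCocone (X.X n) n) (i := i)
    (fun n => ModuleCat.ofHom (LinearMap.pi fun _ => LinearMap.id)) (fun n => 0)
    (fun n => (ModuleCat.isZero_of_subsingleton (ModuleCat.of R PUnit)).eq_of_tgt _ _)
  refine ⟨s.down, fun n hn => ?_⟩
  have : Subsingleton (X.X n) := subsingleton_of_forall_eq 0 fun x =>
    congrFun (ConcreteCategory.congr_hom (h n) x) ⟨hn⟩
  exact ModuleCat.isZero_of_subsingleton _

end Bounded

section Converse

variable {C : Type (u + 1)} [Category.{u} C] [HasZeroMorphisms C]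
  {X : ChainComplex C ℤ}

lemma ChainComplex.exists_comp_map_eq {s : Finset ℤ} (hs : ∀ n ∉ s, IsZero (X.X n))
    (hX : ∀ n, IsFinitelyPresentableObj (X.X n)) {J : Type u} [SmallCategory J] [IsFiltered J]
    {D : ℤ → J ⥤ C} {c : ∀ n, Cocone (D n)} (hc : ∀ n, IsColimit (c n)) {i : J}
    (f g : ∀ n, X.X n ⟶ (D n).obj i) (h : ∀ n, f n ≫ (c n).ι.app i = g n ≫ (c n).ι.app i) :
    ∃ (k : J) (u : i ⟶ k), ∀ n, f n ≫ (D n).map u = g n ≫ (D n).map u := by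
  obtain ⟨k, hk⟩ := IsFiltered.exists_forall_mem (J := Under i) s
    (fun n k => f n ≫ (D n).map k.hom = g n ≫ (D n).map k.hom)
    (fun n k l u hn => by
      rw [← Under.w u, Functor.map_comp, reassoc_of% hn])
    (fun n _ =>
      let ⟨k, u, hu⟩ := (hX n).exists_eq (hc n) (f n) (g n) (h n)
      ⟨Under.mk u, hu⟩)
  refine ⟨k.right, k.hom, fun n => ?_⟩
  by_cases hn : n ∈ s
  · exact hk n hn
  · exact (hs n hn).eq_of_src _ _

lemma ChainComplex.isFinitelyPresentableObj [HasFilteredColimits C] {s : Finset ℤ}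
    (hs : ∀ n ∉ s, IsZero (X.X n))
    (hX : ∀ n, IsFinitelyPresentableObj (X.X n)) : IsFinitelyPresentableObj X := by
  refine isFinitelyPresentableObj_of_exists ?_ ?_
  · intro J _ _ F c hc f
    have hc' (n : ℤ) := isColimitOfPreserves (HomologicalComplex.eval C _ n) hc
    obtain ⟨j, hj⟩ := IsFiltered.exists_forall_mem (J := J) s
      (fun n j => ∃ p : X.X n ⟶ (F.obj j).X n, p ≫ (c.ι.app j).f n = f.f n)
      (fun n i j u ⟨p, hp⟩ => ⟨p ≫ (F.map u).f n, by
        rw [← hp, ← c.w u, Category.assoc, HomologicalComplex.comp_f]⟩)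
      (fun n _ => (hX n).exists_hom (hc' n) (f.f n))
    have hj' (n : ℤ) : ∃ p : X.X n ⟶ (F.obj j).X n, p ≫ (c.ι.app j).f n = f.f n := by
      by_cases hn : n ∈ s
      · exact hj n hn
      · exact ⟨0, (hs n hn).eq_of_src _ _⟩
    choose p hp using hj'
    obtain ⟨k, u, hu⟩ := exists_comp_map_eq hs hX
      (D := fun n => F ⋙ HomologicalComplex.eval C _ (n - 1)) (fun n => hc' (n - 1))
      (fun n => p n ≫ (F.obj j).d n (n - 1)) (fun n => X.d n (n - 1) ≫ p (n - 1)) (by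
        intro n
        change (p n ≫ (F.obj j).d n (n - 1)) ≫ (c.ι.app j).f (n - 1) =
          (X.d n (n - 1) ≫ p (n - 1)) ≫ (c.ι.app j).f (n - 1)
        rw [Category.assoc, ← HomologicalComplex.Hom.comm, reassoc_of% hp n, Category.assoc,
          hp]
        exact f.comm n (n - 1))
    refine ⟨k, { f n := p n ≫ (F.map u).f n, comm' m n hmn := ?_ }, ?_⟩
    · obtain rfl : m - 1 = n := by simp [← (show n + 1 = m from hmn)]
      have : (p m ≫ (F.obj j).d m (m - 1)) ≫ (F.map u).f (m - 1) =
          (X.d m (m - 1) ≫ p (m - 1)) ≫ (F.map u).f (m - 1) := hu m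
      simpa using this
    · ext n : 1
      simp only [HomologicalComplex.comp_f, Category.assoc]
      rw [← HomologicalComplex.comp_f, c.w, hp]
  · intro J _ _ F c hc i f g h
    obtain ⟨k, u, hu⟩ := exists_comp_map_eq hs hX
      (fun n => isColimitOfPreserves (HomologicalComplex.eval C _ n) hc) f.f g.f
      (fun n => congrArg (fun φ => φ.f n) h)
    exact ⟨k, u, HomologicalComplex.hom_ext _ _ hu⟩

end Converse

/-- In `Ch(R)`, an object is finitely presentable iff it is a bounded complex of
finitely presentable `R`-modules. -/
theorem chainComplex_finitelyPresentable_iff {R : Type u} [Ring R]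
    (X : ChainComplex (ModuleCat.{u} R) ℤ) :
    IsFinitelyPresentableObj X ↔
      ((∃ s : Finset ℤ, ∀ n ∉ s, IsZero (X.X n)) ∧
        ∀ n : ℤ, Module.FinitePresentation R (X.X n)) := by
  refine ⟨fun hX => ⟨hX.exists_finset_isZero, fun n =>
    ModuleCat.isFinitelyPresentableObj_iff.1 (hX.chainComplex_X n)⟩, ?_⟩
  rintro ⟨⟨s, hs⟩, hX⟩
  exact ChainComplex.isFinitelyPresentableObj hs fun n =>
    ModuleCat.isFinitelyPresentableObj_iff.2 (hX n)
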